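/- ∫₀¹ log(x⁵ + 1)/(x + 1) dx = (5/2)·log²2 − π²/5 + (1/2)·Li₂((5 + √5)/8) + (1/2)·Li₂((5 − √5)/8). -/

import Mathlib

open Real MeasureTheory intervalIntegral Finset

/-- Dilogarithm Li₂(z) = Σ_{k≥1} z^k/k². -/
noncomputable def Li2 (x : ℝ) : ℝ := ∑' k : ℕ, x ^ (k + 1) / ((k : ℝ) + 1) ^ 2

lemma Li2_deriv (y : ℝ) (h0 : 0 ≤ y) (h1 : y < 1) :
    HasDerivAt Li2 (∑' k : ℕ, y ^ k / ((k : ℝ) + 1)) y := by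
  obtain ⟨r, hr, hr1⟩ := exists_between h1
  have hr0 : 0 < r := lt_of_le_of_lt h0 hr
  refine hasDerivAt_tsum_of_isPreconnected (u := fun k : ℕ => r ^ k)
    (g := fun (k : ℕ) (x : ℝ) => x ^ (k + 1) / ((k : ℝ) + 1) ^ 2)
    (g' := fun (k : ℕ) (x : ℝ) => x ^ k / ((k : ℝ) + 1)) (t := Set.Ioo (-r) r) (y₀ := 0)
    (summable_geometric_of_lt_one hr0.le hr1) isOpen_Ioo isPreconnected_Ioo ?_ ?_ ?_ ?_ ?_
  · intro n x _
    have h := (hasDerivAt_pow (n + 1) x).div_const (((n : ℝ) + 1) ^ 2)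
    refine h.congr_deriv ?_
    have : (n : ℝ) + 1 ≠ 0 := by positivity
    push_cast
    field_simp
  · intro n x hx
    have hxr : |x| ≤ r := abs_le.2 ⟨hx.1.le, hx.2.le⟩
    rw [norm_div, norm_pow, Real.norm_eq_abs, Real.norm_eq_abs,
      abs_of_pos (by positivity : (0:ℝ) < (n:ℝ) + 1)]
    calc |x| ^ n / ((n:ℝ) + 1) ≤ |x| ^ n := div_le_self (by positivity) (by simp)
      _ ≤ r ^ n := by gcongr
  · exact ⟨by linarith, hr0⟩
  · simp
  · exact ⟨by linarith, hr⟩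

lemma Li2_deriv' (y : ℝ) (h0 : 0 < y) (h1 : y < 1) :
    HasDerivAt Li2 (-Real.log (1 - y) / y) y := by
  convert Li2_deriv y h0.le h1 using 1
  rw [← (Real.hasSum_pow_div_log_of_abs_lt_one (x := y) (by rw [abs_of_pos h0]; exact h1)).tsum_eq,
    div_eq_mul_inv, ← tsum_mul_right]
  congr 1; ext k
  field_simp
  ring

lemma q_pos (c x : ℝ) (hc : c < 1) (hx : 0 ≤ x) : 0 < x ^ 2 - 2 * x * c + 1 := by
  rcases hx.eq_or_lt with h | h
  · subst h; norm_num
  · nlinarith [sq_nonneg (x - 1), mul_pos h (sub_pos.2 hc)]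

noncomputable def GG (c : ℝ) : ℝ := ∫ x in (0:ℝ)..1, Real.log (x ^ 2 - 2 * x * c + 1) / (x + 1)

lemma GG_int (c : ℝ) (hc : c < 1) :
    IntervalIntegrable (fun x : ℝ => Real.log (x ^ 2 - 2 * x * c + 1) / (x + 1)) volume 0 1 := by
  apply ContinuousOn.intervalIntegrable
  rw [Set.uIcc_of_le zero_le_one]
  refine ContinuousOn.div (ContinuousOn.log (by fun_prop) ?_) (by fun_prop) ?_
  · intro x hx; exact (q_pos c x hc hx.1).ne'
  · intro x hx; linarith [hx.1]

lemma GG_deriv (c : ℝ) (hc : c < 1) :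
    IntervalIntegrable (fun x : ℝ => (-2 * x) / (x ^ 2 - 2 * x * c + 1) / (x + 1)) volume 0 1 ∧
    HasDerivAt GG (∫ x in (0:ℝ)..1, (-2 * x) / (x ^ 2 - 2 * x * c + 1) / (x + 1)) c := by
  obtain ⟨m, hm, hm1⟩ := exists_between hc
  refine intervalIntegral.hasDerivAt_integral_of_dominated_loc_of_deriv_le
    (F := fun c x : ℝ => Real.log (x ^ 2 - 2 * x * c + 1) / (x + 1))
    (F' := fun c x : ℝ => (-2 * x) / (x ^ 2 - 2 * x * c + 1) / (x + 1))
    (bound := fun _ => 1 / (1 - m)) (s := Set.Iio m) (Iio_mem_nhds hm) ?_ (GG_int c hc) ?_ ?_ ?_ ?_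
  · refine Filter.Eventually.of_forall fun c => Measurable.aestronglyMeasurable ?_
    fun_prop
  · refine Measurable.aestronglyMeasurable ?_
    fun_prop
  · refine Filter.Eventually.of_forall fun x hx c' hc' => ?_
    rw [Set.uIoc_of_le zero_le_one] at hx
    have hx0 := hx.1
    have hc'' : c' < m := hc'
    have hq := q_pos c' x (hc''.trans hm1) hx0.le
    have h1m : 0 < 1 - m := by linarith
    rw [norm_div, norm_div, Real.norm_eq_abs, Real.norm_eq_abs, Real.norm_eq_abs,
      abs_of_pos hq, abs_of_pos (by linarith : 0 < x + 1), abs_of_neg (by linarith : -2 * x < 0)]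
    refine (div_le_self (by apply div_nonneg <;> linarith) (by linarith)).trans ?_
    rw [div_le_div_iff₀ hq h1m]
    nlinarith [sq_nonneg (x - 1), mul_pos hx0 (sub_pos.2 hc'')]
  · exact intervalIntegrable_const
  · refine Filter.Eventually.of_forall fun x hx c' hc' => ?_
    rw [Set.uIoc_of_le zero_le_one] at hx
    have hc'' : c' < m := hc'
    have hq := q_pos c' x (hc''.trans hm1) hx.1.le
    have h1 : HasDerivAt (fun c : ℝ => x ^ 2 - 2 * x * c + 1) (-2 * x) c' := by
      have := (((hasDerivAt_id c').const_mul (2 * x)).const_sub (x ^ 2)).add_const 1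
      refine this.congr_deriv ?_; simp
    exact (h1.log hq.ne').div_const _

lemma GG_deriv_val (t : ℝ) (h0 : 0 < t) (h1 : t < π) :
    ∫ x in (0:ℝ)..1, (-2 * x) / (x ^ 2 - 2 * x * cos t + 1) / (x + 1)
      = -(1 / (1 + cos t)) * (1 / 2 * Real.log ((1 - cos t) / 2)
        + (1 + cos t) / sin t * ((π - t) / 2)) := by
  have hs : 0 < sin t := sin_pos_of_pos_of_lt_pi h0 h1
  have hsc := sin_sq_add_cos_sq t
  have hc1 : cos t < 1 := by nlinarith [cos_le_one t]
  have hc2 : 0 < 1 + cos t := by nlinarith [neg_one_le_cos t]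
  have key : ∀ x ∈ Set.uIcc (0:ℝ) 1, HasDerivAt
      (fun x : ℝ => -(1 / (1 + cos t)) * (1 / 2 * Real.log (x ^ 2 - 2 * x * cos t + 1)
        + (1 + cos t) / sin t * arctan ((x - cos t) / sin t) - Real.log (x + 1)))
      ((-2 * x) / (x ^ 2 - 2 * x * cos t + 1) / (x + 1)) x := by
    intro x hx
    rw [Set.uIcc_of_le zero_le_one] at hx
    have hq := q_pos _ x hc1 hx.1
    have hx1 : 0 < x + 1 := by linarith [hx.1]
    have e1 : HasDerivAt (fun x : ℝ => x ^ 2 - 2 * x * cos t + 1) (2 * x - 2 * cos t) x := by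
      have := (((hasDerivAt_pow 2 x).sub
        (((hasDerivAt_id x).const_mul 2).mul_const (cos t))).add_const 1)
      refine this.congr_deriv ?_; simp
    have e2 : HasDerivAt (fun x : ℝ => (x - cos t) / sin t) (1 / sin t) x :=
      ((hasDerivAt_id x).sub_const _).div_const _
    have e3 : HasDerivAt (fun x : ℝ => x + 1) 1 x := (hasDerivAt_id x).add_const 1
    have := ((((e1.log hq.ne').const_mul (1/2)).add
      (e2.arctan.const_mul ((1 + cos t) / sin t))).sub (e3.log hx1.ne')).const_mul
        (-(1 / (1 + cos t)))
    refine this.congr_deriv ?_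
    have h3 : 1 + ((x - cos t) / sin t) ^ 2 = (x ^ 2 - 2 * x * cos t + 1) / sin t ^ 2 := by
      field_simp; linarith
    rw [h3]
    have hq' := hq.ne'
    clear h3 this e1 hq
    generalize hQ : x ^ 2 - 2 * x * cos t + 1 = Q at *
    field_simp
    first
      | linear_combination hQ
      | linear_combination -hQ
      | linear_combination 2 * hQ
      | linear_combination -2 * hQ
  rw [intervalIntegral.integral_eq_sub_of_hasDerivAt key (GG_deriv _ hc1).1]
  have a1 : arctan ((1 - cos t) / sin t) = t / 2 := by
    rw [← arctan_tan (x := t / 2) (by linarith) (by linarith), tan_eq_sin_div_cos]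
    congr 1
    have hch : 0 < cos (t / 2) := cos_pos_of_mem_Ioo ⟨by linarith, by linarith⟩
    rw [div_eq_div_iff hs.ne' hch.ne']
    have e1 : cos t = 2 * cos (t/2) ^ 2 - 1 := by rw [← cos_two_mul]; congr 1; ring
    have e2 : sin t = 2 * sin (t/2) * cos (t/2) := by rw [← sin_two_mul]; congr 1; ring
    rw [e1, e2]
    linear_combination (-2 * cos (t/2)) * sin_sq_add_cos_sq (t/2)
  have a2 : arctan ((0 - cos t) / sin t) = t - π / 2 := by
    rw [← arctan_tan (x := t - π / 2) (by linarith) (by linarith), tan_eq_sin_div_cos]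
    congr 1
    rw [sin_sub_pi_div_two, cos_sub_pi_div_two]; simp
  have l1 : Real.log ((1:ℝ) ^ 2 - 2 * 1 * cos t + 1) = Real.log ((1 - cos t) / 2) + 2 * Real.log 2 := by
    rw [show (1:ℝ) ^ 2 - 2 * 1 * cos t + 1 = (1 - cos t) / 2 * 2 ^ 2 by ring,
      Real.log_mul (by linarith) (by norm_num), Real.log_pow]; norm_num
  rw [a1, a2, l1]
  norm_num
  ring

lemma base_int : ∫ x in (0:ℝ)..1, Real.log (x + 1) / (x + 1) = Real.log 2 ^ 2 / 2 := by
  have key : ∀ x ∈ Set.uIcc (0:ℝ) 1, HasDerivAt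
      (fun x : ℝ => Real.log (x + 1) ^ 2 / 2) (Real.log (x + 1) / (x + 1)) x := by
    intro x hx
    rw [Set.uIcc_of_le zero_le_one] at hx
    have hx1 : x + 1 ≠ 0 := by linarith [hx.1]
    have e3 : HasDerivAt (fun x : ℝ => x + 1) 1 x := (hasDerivAt_id x).add_const 1
    have := ((e3.log hx1).pow 2).div_const 2
    refine this.congr_deriv ?_
    field_simp
    simp
  rw [intervalIntegral.integral_eq_sub_of_hasDerivAt key]
  · norm_num
  · apply ContinuousOn.intervalIntegrable
    rw [Set.uIcc_of_le zero_le_one]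
    refine ContinuousOn.div (ContinuousOn.log (by fun_prop) ?_) (by fun_prop) ?_ <;>
    · intro x hx; linarith [hx.1]

lemma GG_neg_one : GG (-1) = Real.log 2 ^ 2 := by
  have : GG (-1) = ∫ x in (0:ℝ)..1, 2 * (Real.log (x + 1) / (x + 1)) := by
    unfold GG
    congr 1; ext x
    rw [show x ^ 2 - 2 * x * (-1) + 1 = (x + 1) ^ 2 by ring, Real.log_pow]
    push_cast; ring
  rw [this, intervalIntegral.integral_const_mul, base_int]; ring

lemma GG_val (t : ℝ) (h0 : 0 < t) (h1 : t < π) :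
    GG (cos t) = Real.log 2 ^ 2 + 1 / 2 * Li2 ((1 + cos t) / 2) - (π - t) ^ 2 / 4 := by
  have hct : ∀ u ∈ Set.Icc t π, cos u < 1 := by
    intro u hu
    have : cos u < cos 0 := cos_lt_cos_of_nonneg_of_le_pi le_rfl hu.2 (by linarith [hu.1])
    simpa using this
  have hb : ∀ u : ℝ, HasDerivAt (fun u : ℝ => (1 + cos u) / 2) (-sin u / 2) u := fun u =>
    ((hasDerivAt_cos u).const_add 1).div_const 2
  have hd : ∀ u : ℝ, HasDerivAt (fun u : ℝ => (π - u) ^ 2 / 4) (-(π - u) / 2) u := fun u => by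
    have := (((hasDerivAt_id u).const_sub π).pow 2).div_const 4
    refine this.congr_deriv ?_
    simp; ring
  have hcont : ContinuousOn
      (fun u => GG (cos u) - 1 / 2 * Li2 ((1 + cos u) / 2) + (π - u) ^ 2 / 4) (Set.Icc t π) := by
    intro u hu
    have hc := hct u hu
    have d1 := (GG_deriv _ hc).2.comp u (hasDerivAt_cos u)
    have d2 := (Li2_deriv ((1 + cos u) / 2) (by linarith [neg_one_le_cos u]) (by linarith)).comp u (hb u)
    exact ((d1.sub (d2.const_mul (1/2))).add (hd u)).continuousAt.continuousWithinAt
  have hder : ∀ u ∈ Set.Ico t π, HasDerivWithinAt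
      (fun u => GG (cos u) - 1 / 2 * Li2 ((1 + cos u) / 2) + (π - u) ^ 2 / 4) 0 (Set.Ici u) u := by
    intro u hu
    have hc := hct u ⟨hu.1, hu.2.le⟩
    have hs : 0 < sin u := sin_pos_of_pos_of_lt_pi (by linarith [hu.1]) hu.2
    have hc2 : 0 < 1 + cos u := by nlinarith [neg_one_le_cos u, sin_sq_add_cos_sq u]
    have d1 := (GG_deriv _ hc).2.comp u (hasDerivAt_cos u)
    rw [GG_deriv_val u (by linarith [hu.1]) hu.2] at d1
    have d2 := (Li2_deriv' ((1 + cos u) / 2) (by linarith) (by linarith)).comp u (hb u)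
    have := ((d1.sub (d2.const_mul (1/2))).add (hd u))
    refine HasDerivAt.hasDerivWithinAt ?_
    refine this.congr_deriv ?_
    rw [show 1 - (1 + cos u) / 2 = (1 - cos u) / 2 by ring]
    field_simp
    ring
  have := constant_of_has_deriv_right_zero hcont hder π ⟨h1.le, le_rfl⟩
  have hL : Li2 0 = 0 := by simp [Li2]
  simp only [cos_pi, GG_neg_one] at this
  norm_num [hL] at this
  linarith

theorem stmt_13 :
    ∫ x in (0:ℝ)..1, Real.log (x ^ 5 + 1) / (x + 1) =
      (5 / 2) * Real.log 2 ^ 2 - π ^ 2 / 5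
        + (1 / 2) * Li2 ((5 + Real.sqrt 5) / 8)
        + (1 / 2) * Li2 ((5 - Real.sqrt 5) / 8) := by
  have hp := pi_pos
  have h5 : Real.sqrt 5 ^ 2 = 5 := Real.sq_sqrt (by norm_num)
  have c1 : cos (π / 5) = (1 + √5) / 4 := Real.cos_pi_div_five
  have c2 : cos (3 * π / 5) = (1 - √5) / 4 := by
    rw [show 3 * π / 5 = π - 2 * (π / 5) by ring, cos_pi_sub, cos_two_mul, c1]
    linear_combination (-1/8) * h5
  have g1 := GG_val (π / 5) (by linarith) (by linarith)
  have g2 := GG_val (3 * π / 5) (by linarith) (by linarith)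
  rw [c1] at g1
  rw [c2] at g2
  have hs0 := Real.sqrt_nonneg 5
  have i1 : (1 + √5) / 4 < 1 := by nlinarith
  have i2 : (1 - √5) / 4 < 1 := by linarith
  have I0 : IntervalIntegrable (fun x : ℝ => Real.log (x + 1) / (x + 1)) volume 0 1 := by
    apply ContinuousOn.intervalIntegrable
    rw [Set.uIcc_of_le zero_le_one]
    refine ContinuousOn.div (ContinuousOn.log (by fun_prop) ?_) (by fun_prop) ?_ <;>
    · intro x hx; linarith [hx.1]
  have split : ∫ x in (0:ℝ)..1, Real.log (x ^ 5 + 1) / (x + 1)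
      = ∫ x in (0:ℝ)..1, (Real.log (x + 1) / (x + 1)
        + Real.log (x ^ 2 - 2 * x * ((1 + √5) / 4) + 1) / (x + 1)
        + Real.log (x ^ 2 - 2 * x * ((1 - √5) / 4) + 1) / (x + 1)) := by
    apply intervalIntegral.integral_congr
    intro x hx
    rw [Set.uIcc_of_le zero_le_one] at hx
    have q0 : 0 < x + 1 := by linarith [hx.1]
    have q1 := q_pos _ x i1 hx.1
    have q2 := q_pos _ x i2 hx.1
    have hf : x ^ 5 + 1 = (x + 1) * (x ^ 2 - 2 * x * ((1 + √5) / 4) + 1)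
        * (x ^ 2 - 2 * x * ((1 - √5) / 4) + 1) := by
      linear_combination (x + 1) * x ^ 2 / 4 * h5
    simp only
    rw [hf, Real.log_mul (by positivity) q2.ne', Real.log_mul q0.ne' q1.ne']
    ring
  rw [split, intervalIntegral.integral_add (I0.add (GG_int _ i1)) (GG_int _ i2),
    intervalIntegral.integral_add I0 (GG_int _ i1), base_int]
  unfold GG at g1 g2
  rw [g1, g2, show (1 + (1 + √5) / 4) / 2 = (5 + √5) / 8 by ring,
    show (1 + (1 - √5) / 4) / 2 = (5 - √5) / 8 by ring]
  ring
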